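/- arXiv:2011.10761 — 2 statements merged into one kernel-verified Lean document; each statement's English description precedes it below -/
import Mathlib

section
/- For every natural number m ≥ 1 and every natural number r with 0 < r ≤ 2^m, the binomial coefficient C(2^(m+1) − r, 2^m − r) is odd, i.e. C(2^(m+1) − r, 2^m − r) ≡ 1 (mod 2). -/
theorem choose_aux (m : ℕ) : ∀ s : ℕ, s < 2 ^ m → Nat.choose (2 ^ m + s) s % 2 = 1 := by
  induction m with
  | zero => intro s hs; have : s = 0 := by simpa using hs
            subst this; simp
  | succ m ih =>
    intro s hs
    haveI : Fact (Nat.Prime 2) := ⟨Nat.prime_two⟩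
    have h : Nat.choose (2 ^ (m + 1) + s) s ≡ _ [MOD 2] :=
      Choose.choose_modEq_choose_mod_mul_choose_div_nat
    rw [pow_succ] at hs h ⊢
    have h1 : (2 ^ m * 2 + s) % 2 = s % 2 := by omega
    have h2 : (2 ^ m * 2 + s) / 2 = 2 ^ m + s / 2 := by omega
    rw [h1, h2, Nat.choose_self, one_mul] at h
    have h3 := ih (s / 2) (by omega)
    unfold Nat.ModEq at h
    omega

/-- For every `m ≥ 1` and every `r` with `0 < r ≤ 2^m`, the binomial
coefficient `C(2^(m+1) - r, 2^m - r)` is odd. -/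
theorem choose_pow_two_sub_odd (m r : ℕ) (hm : 1 ≤ m) (hr : 0 < r) (hr2 : r ≤ 2 ^ m) :
    Nat.choose (2 ^ (m + 1) - r) (2 ^ m - r) % 2 = 1 := by
  have h : 2 ^ (m + 1) - r = 2 ^ m + (2 ^ m - r) := by rw [pow_succ]; omega
  rw [h]
  exact choose_aux m _ (by omega)
end

section
/- Let 3 ≤ r < n. The involutions S and T on X_{n,r} generate (together with S∘T and the identity) an action of the Klein four-group ℤ/2 × ℤ/2 on X_{n,r}, and this action is free: no nonidentity element of the group fixes any point of X_{n,r}. -/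
open Matrix

/-- The Stiefel manifold `V_{n,r}` of orthonormal `r`-frames in `ℝⁿ`, realized as the
space of `n × r` real matrices `A` with `Aᵀ * A = 1`, topologized as a subspace of the
space of `n × r` matrices. -/
def Stiefel (n r : ℕ) : Type :=
  { A : Matrix (Fin n) (Fin r) ℝ // Aᵀ * A = 1 }

instance (n r : ℕ) : TopologicalSpace (Stiefel n r) :=
  instTopologicalSpaceSubtype

/-- The setoid identifying a frame `A` with its negative `-A`. -/
instance stiefelSetoid (n r : ℕ) : Setoid (Stiefel n r) where
  r A B := B.1 = A.1 ∨ B.1 = -A.1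
  iseqv := by
    constructor
    · intro A; exact Or.inl rfl
    · rintro A B (h | h)
      · exact Or.inl h.symm
      · right; rw [h, neg_neg]
    · rintro A B C (h1 | h1) (h2 | h2)
      · exact Or.inl (h2.trans h1)
      · right; rw [h2, h1]
      · right; rw [h2, h1]
      · left; rw [h2, h1, neg_neg]

/-- The projective Stiefel manifold `X_{n,r}`, the quotient of `V_{n,r}` by `A ∼ -A`,
with the quotient topology. -/
def PStiefel (n r : ℕ) : Type := Quotient (stiefelSetoid n r)

instance (n r : ℕ) : TopologicalSpace (PStiefel n r) :=
  instTopologicalSpaceQuotient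

/-- Negation `A ↦ -A` on the Stiefel manifold. -/
def Stiefel.neg {n r : ℕ} (A : Stiefel n r) : Stiefel n r :=
  ⟨-A.1, by rw [Matrix.transpose_neg, Matrix.neg_mul, Matrix.mul_neg, neg_neg]; exact A.2⟩


/-- The matrix obtained from `A` by negating its `j`-th column. -/
def negCol {n r : ℕ} (j : Fin r) (A : Matrix (Fin n) (Fin r) ℝ) : Matrix (Fin n) (Fin r) ℝ :=
  fun i k => if k = j then -A i k else A i k


/-- sign character of `ZMod 2` -/
noncomputable def sgz (a : ZMod 2) : ℝ := if a = 0 then 1 else -1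

lemma sgz_add (a b : ZMod 2) : sgz (a + b) = sgz a * sgz b := by
  have h : ∀ a : ZMod 2, a = 0 ∨ a = 1 := by decide
  have h2 : (1 : ZMod 2) + 1 = 0 := by decide
  rcases h a with rfl | rfl <;> rcases h b with rfl | rfl <;> simp [sgz, h2]

lemma sgz_sq (a : ZMod 2) : sgz a * sgz a = 1 := by
  unfold sgz; split_ifs <;> norm_num

lemma sgz_eq_one {a : ZMod 2} (h : sgz a = 1) : a = 0 := by
  unfold sgz at h
  split_ifs at h with h0
  · exact h0
  · norm_num at h

/-- the sign by which a group element acts on the `k`-th column -/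
noncomputable def colSign {r : ℕ} (g : ZMod 2 × ZMod 2) (k : Fin r) : ℝ :=
  if k.val = 0 then sgz g.1 else if k.val = 1 then sgz g.2 else 1

lemma colSign_add {r : ℕ} (g h : ZMod 2 × ZMod 2) (k : Fin r) :
    colSign (g + h) k = colSign g k * colSign h k := by
  unfold colSign; split_ifs <;> simp [sgz_add]

lemma colSign_zero {r : ℕ} (k : Fin r) : colSign 0 k = 1 := by
  unfold colSign; simp [sgz]

lemma colSign_sq {r : ℕ} (g : ZMod 2 × ZMod 2) (k : Fin r) :
    colSign g k * colSign g k = 1 := by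
  unfold colSign; split_ifs <;> simp [sgz_sq]

/-- action on matrices -/
noncomputable def actM {n r : ℕ} (g : ZMod 2 × ZMod 2) (A : Matrix (Fin n) (Fin r) ℝ) :
    Matrix (Fin n) (Fin r) ℝ := fun i k => colSign g k * A i k

lemma actM_orth {n r : ℕ} (g : ZMod 2 × ZMod 2) (A : Matrix (Fin n) (Fin r) ℝ)
    (hA : Aᵀ * A = 1) : (actM g A)ᵀ * actM g A = 1 := by
  ext j k
  have h := congrFun (congrFun hA j) k
  rw [Matrix.mul_apply] at h ⊢
  have e : ∀ i, (actM g A)ᵀ j i * actM g A i k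
      = (colSign g j * colSign g k) * (Aᵀ j i * A i k) := by
    intro i; simp only [actM, Matrix.transpose_apply]; ring
  simp only [e, ← Finset.mul_sum, h]
  by_cases hjk : j = k
  · subst hjk; simp [colSign_sq]
  · simp [Matrix.one_apply_ne hjk]

/-- action on the Stiefel manifold -/
noncomputable def actS {n r : ℕ} (g : ZMod 2 × ZMod 2) (A : Stiefel n r) : Stiefel n r :=
  ⟨actM g A.1, actM_orth g A.1 A.2⟩

lemma actM_neg {n r : ℕ} (g : ZMod 2 × ZMod 2) (A : Matrix (Fin n) (Fin r) ℝ) :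
    actM g (-A) = -actM g A := by
  ext i k; simp [actM]

/-- action on the projective Stiefel manifold -/
noncomputable def actP {n r : ℕ} (g : ZMod 2 × ZMod 2) : PStiefel n r → PStiefel n r :=
  Quotient.map (actS g) (by
    rintro A B (h | h)
    · left; change actM g B.1 = actM g A.1; rw [h]
    · right; change actM g B.1 = -actM g A.1; rw [h, actM_neg])

/-- the action homomorphism -/
noncomputable def actHom (n r : ℕ) :
    Multiplicative (ZMod 2 × ZMod 2) →* Function.End (PStiefel n r) where
  toFun g := actP g.toAdd
  map_one' := by
    funext x
    induction x using Quotient.inductionOn with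
    | h A =>
      change (⟦actS 0 A⟧ : Quotient (stiefelSetoid n r)) = ⟦A⟧
      congr 1
      apply Subtype.ext
      ext i k
      simp [actS, actM, colSign_zero]
  map_mul' g h := by
    funext x
    induction x using Quotient.inductionOn with
    | h A =>
      change (⟦actS (g.toAdd + h.toAdd) A⟧ : Quotient (stiefelSetoid n r))
        = ⟦actS g.toAdd (actS h.toAdd A)⟧
      congr 1
      apply Subtype.ext
      ext i k
      simp [actS, actM, colSign_add, mul_assoc]

lemma col_ne {n r : ℕ} (A : Stiefel n r) (k : Fin r) : ∃ i, A.1 i k ≠ 0 := by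
  by_contra! hc
  have h := congrFun (congrFun A.2 k) k
  rw [Matrix.mul_apply] at h
  simp [hc] at h

/-- For `3 ≤ r < n`, the involutions `S` and `T` (negating the first,
respectively the second, column of a frame) generate an action of the Klein four-group
`ℤ/2 × ℤ/2` on `X_{n,r}`, and this action is free: no nonidentity group element fixes
any point of `X_{n,r}`. -/
theorem pstiefel_klein_four_free_action (n r : ℕ) (h3 : 3 ≤ r) (hrn : r < n) :
    ∃ φ : Multiplicative (ZMod 2 × ZMod 2) →* Equiv.Perm (PStiefel n r),
      (∀ A : Stiefel n r,
        ∃ h : (negCol ⟨0, by omega⟩ A.1)ᵀ * negCol ⟨0, by omega⟩ A.1 = 1,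
          φ (Multiplicative.ofAdd ((1 : ZMod 2), (0 : ZMod 2))) ⟦A⟧ =
            ⟦(⟨negCol ⟨0, by omega⟩ A.1, h⟩ : Stiefel n r)⟧) ∧
      (∀ A : Stiefel n r,
        ∃ h : (negCol ⟨1, by omega⟩ A.1)ᵀ * negCol ⟨1, by omega⟩ A.1 = 1,
          φ (Multiplicative.ofAdd ((0 : ZMod 2), (1 : ZMod 2))) ⟦A⟧ =
            ⟦(⟨negCol ⟨1, by omega⟩ A.1, h⟩ : Stiefel n r)⟧) ∧
      (∀ g : Multiplicative (ZMod 2 × ZMod 2), g ≠ 1 →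
        ∀ x : PStiefel n r, φ g x ≠ x) := by
  have e0 : ∀ A : Matrix (Fin n) (Fin r) ℝ,
      negCol ⟨0, by omega⟩ A = actM ((1 : ZMod 2), (0 : ZMod 2)) A := by
    intro A; ext i k
    by_cases hk : k.val = 0 <;> simp [negCol, actM, colSign, sgz, Fin.ext_iff, hk]
  have e1 : ∀ A : Matrix (Fin n) (Fin r) ℝ,
      negCol ⟨1, by omega⟩ A = actM ((0 : ZMod 2), (1 : ZMod 2)) A := by
    intro A; ext i k
    by_cases hk : k.val = 1 <;> simp [negCol, actM, colSign, sgz, Fin.ext_iff, hk]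
  refine ⟨(actHom n r).toHomPerm, ?_, ?_, ?_⟩
  · intro A
    refine ⟨by rw [e0]; exact actM_orth _ _ A.2, ?_⟩
    change (⟦actS ((1 : ZMod 2), (0 : ZMod 2)) A⟧ : Quotient (stiefelSetoid n r)) = _
    congr 1
    exact Subtype.ext (e0 A.1).symm
  · intro A
    refine ⟨by rw [e1]; exact actM_orth _ _ A.2, ?_⟩
    change (⟦actS ((0 : ZMod 2), (1 : ZMod 2)) A⟧ : Quotient (stiefelSetoid n r)) = _
    congr 1
    exact Subtype.ext (e1 A.1).symm
  · intro g hg x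
    induction x using Quotient.inductionOn with
    | h A =>
      intro h
      change (⟦actS g.toAdd A⟧ : Quotient (stiefelSetoid n r)) = ⟦A⟧ at h
      have h' : A.1 = actM g.toAdd A.1 ∨ A.1 = -actM g.toAdd A.1 := Quotient.exact h
      rcases h' with h' | h'
      · have key : ∀ k : Fin r, colSign g.toAdd k = 1 := by
          intro k
          obtain ⟨i, hi⟩ := col_ne A k
          have := congrFun (congrFun h' i) k
          simp only [actM] at this
          exact mul_right_cancel₀ hi (by rw [one_mul]; exact this.symm)
        have k0 := key ⟨0, by omega⟩
        have k1 := key ⟨1, by omega⟩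
        simp only [colSign, if_true, one_ne_zero, if_false] at k0 k1
        apply hg
        apply Multiplicative.toAdd.injective
        exact Prod.ext (sgz_eq_one k0) (sgz_eq_one k1)
      · obtain ⟨i, hi⟩ := col_ne A ⟨2, by omega⟩
        have := congrFun (congrFun h' i) ⟨2, by omega⟩
        simp [actM, colSign] at this
        exact hi (by linarith)
end
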